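/- arXiv:cs/0407007 — 2 statements merged into one kernel-verified Lean document; each statement's English description precedes it below -/
import Mathlib

section
/- The duplicator wins the infinite semijoin game SG⟨ā; b̄⟩ (i.e. the spoiler has no winning strategy) if and only if for every semijoin algebra expression E, ā ∈ E(A) ⇔ b̄ ∈ E(B). -/
/-- Quantifier-free formulas over a vocabulary `Ω` of predicates (with arities
given by `ωar`) and with equality built in, on `n` variables. -/
inductive QF (Ω : Type) (ωar : Ω → ℕ) : ℕ → Type
  | atom {n : ℕ} (p : Ω) (v : Fin (ωar p) → Fin n) : QF Ω ωar n
  | eq {n : ℕ} (i j : Fin n) : QF Ω ωar n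
  | not {n : ℕ} : QF Ω ωar n → QF Ω ωar n
  | and {n : ℕ} : QF Ω ωar n → QF Ω ωar n → QF Ω ωar n
  | or {n : ℕ} : QF Ω ωar n → QF Ω ωar n → QF Ω ωar n

/-- Semantics of quantifier-free formulas, given an interpretation `I` of the
predicates of `Ω` over the universe `U`. -/
def QF.holds {Ω : Type} {ωar : Ω → ℕ} {U : Type}
    (I : ∀ p : Ω, (Fin (ωar p) → U) → Prop) :
    ∀ {n : ℕ}, QF Ω ωar n → (Fin n → U) → Prop
  | _, .atom p v, t => I p (t ∘ v)
  | _, .eq i j, t => t i = t j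
  | _, .not φ, t => ¬ QF.holds I φ t
  | _, .and φ ψ, t => QF.holds I φ t ∧ QF.holds I ψ t
  | _, .or φ ψ, t => QF.holds I φ t ∨ QF.holds I ψ t

/-- Quantifier-free formulas over the vocabulary `Ω = {=}` (equality only). -/
abbrev EqForm (n : ℕ) : Type := QF Empty (fun p => p.elim) n

/-- Semantics of quantifier-free formulas over equality. -/
def EqForm.holds {U : Type} {n : ℕ} (θ : EqForm n) (t : Fin n → U) : Prop :=
  QF.holds (fun p => p.elim) θ t

/-- The semijoin algebra SA over a schema `S` (with arities `ar`) and vocabulary `Ω`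
(with arities `ωar`, equality built in): expressions are built from relation names by
union and difference of equal-arity expressions, projection `π_X` (encoded by a
strictly monotone map of columns), selection `σ_θ`, and semijoin `E₁ ⋉_θ E₂`, where
selection and semijoin conditions `θ` are arbitrary quantifier-free formulas over
`Ω`. An expression is indexed by its arity. -/
inductive SA (S : Type) (ar : S → ℕ) (Ω : Type) (ωar : Ω → ℕ) : ℕ → Type
  | rel (R : S) : SA S ar Ω ωar (ar R)
  | union {n : ℕ} : SA S ar Ω ωar n → SA S ar Ω ωar n → SA S ar Ω ωar n
  | diff {n : ℕ} : SA S ar Ω ωar n → SA S ar Ω ωar n → SA S ar Ω ωar n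
  | proj {k n : ℕ} (f : Fin k → Fin n) (hf : StrictMono f) :
      SA S ar Ω ωar n → SA S ar Ω ωar k
  | sel {n : ℕ} (θ : QF Ω ωar n) : SA S ar Ω ωar n → SA S ar Ω ωar n
  | semijoin {n m : ℕ} (θ : QF Ω ωar (n + m)) :
      SA S ar Ω ωar n → SA S ar Ω ωar m → SA S ar Ω ωar n

/-- Evaluation of an SA expression on a database `D`, given an interpretation `I`
of the predicates of `Ω` over the universe `U`. In the semijoin
`E₁ ⋉_θ E₂ = {ā ∈ E₁ ∣ ∃ b̄ ∈ E₂, θ(ā,b̄)}`, the condition `θ` is evaluated on the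
concatenated tuple `(ā,b̄)`. -/
def SA.eval {S : Type} {ar : S → ℕ} {Ω : Type} {ωar : Ω → ℕ} {U : Type}
    (I : ∀ p : Ω, (Fin (ωar p) → U) → Prop)
    (D : ∀ R : S, Set (Fin (ar R) → U)) :
    ∀ {n : ℕ}, SA S ar Ω ωar n → Set (Fin n → U)
  | _, .rel R => D R
  | _, .union E₁ E₂ => SA.eval I D E₁ ∪ SA.eval I D E₂
  | _, .diff E₁ E₂ => SA.eval I D E₁ \ SA.eval I D E₂
  | _, .proj f _ E => {t | ∃ a ∈ SA.eval I D E, t = a ∘ f}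
  | _, .sel θ E => {a ∈ SA.eval I D E | QF.holds I θ a}
  | _, .semijoin θ E₁ E₂ =>
      {a ∈ SA.eval I D E₁ | ∃ b ∈ SA.eval I D E₂, QF.holds I θ (Fin.append a b)}

/-- Membership in the tuple space of a database: `t` is a projection (onto a strictly
increasing sequence of columns) of some tuple of some relation of `D`. -/
def inTupleSpace {S : Type} {ar : S → ℕ} {U : Type}
    (D : ∀ R : S, Set (Fin (ar R) → U)) {k : ℕ} (t : Fin k → U) : Prop :=
  ∃ (R : S) (f : Fin k → Fin (ar R)), StrictMono f ∧ ∃ a ∈ D R, t = a ∘ f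

/-- Condition (1) of the semijoin game: the tuples `a` and `b` belong to exactly the
same projections `π_X(A(R))` resp. `π_X(B(R))`. -/
def samePos {S : Type} {ar : S → ℕ} {U : Type}
    (A B : ∀ R : S, Set (Fin (ar R) → U)) {k : ℕ} (a b : Fin k → U) : Prop :=
  ∀ (R : S) (f : Fin k → Fin (ar R)), StrictMono f →
    ((∃ t ∈ A R, a = t ∘ f) ↔ (∃ t ∈ B R, b = t ∘ f))

/-- Condition (2) of the semijoin game: the tuples `a` and `b` satisfy exactly the
same atomic formulas over the vocabulary `Ω` (equality included). -/
def sameAtomic {Ω : Type} {ωar : Ω → ℕ} {U : Type}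
    (I : ∀ p : Ω, (Fin (ωar p) → U) → Prop) {k : ℕ} (a b : Fin k → U) : Prop :=
  (∀ i j : Fin k, a i = a j ↔ b i = b j) ∧
  ∀ (p : Ω) (v : Fin (ωar p) → Fin k), (I p (a ∘ v) ↔ I p (b ∘ v))

/-- The duplicator wins the `m`-round semijoin game on the databases `A` and `B`
starting from the configuration `⟨a; b⟩`: the configuration satisfies the winning
conditions for the 0-round game, and (if `m > 0`) for every spoiler move (a tuple in
the tuple space of `A`, or of `B`) the duplicator has a legal answer in the other
tuple space from which he wins the game with one round less. -/
def DuplicatorWins {S : Type} {ar : S → ℕ} {Ω : Type} {ωar : Ω → ℕ} {U : Type}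
    (A B : ∀ R : S, Set (Fin (ar R) → U))
    (I : ∀ p : Ω, (Fin (ωar p) → U) → Prop) :
    ℕ → ∀ {k : ℕ}, (Fin k → U) → (Fin k → U) → Prop
  | 0, _, a, b => samePos A B a b ∧ sameAtomic I a b
  | m + 1, _, a, b =>
      (samePos A B a b ∧ sameAtomic I a b) ∧
      (∀ (l : ℕ) (c : Fin l → U), inTupleSpace A c →
        ∃ d : Fin l → U, inTupleSpace B d ∧ samePos A B c d ∧
          sameAtomic I (Fin.append a c) (Fin.append b d) ∧
          DuplicatorWins A B I m c d) ∧
      (∀ (l : ℕ) (d : Fin l → U), inTupleSpace B d →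
        ∃ c : Fin l → U, inTupleSpace A c ∧ samePos A B c d ∧
          sameAtomic I (Fin.append a c) (Fin.append b d) ∧
          DuplicatorWins A B I m c d)

/-- The duplicator wins the infinite semijoin game `SG⟨a; b⟩` on the databases `A`
and `B`: the spoiler has no winning strategy, i.e. the duplicator can keep answering
legally forever. This is expressed coinductively: there is a set `W` of
configurations, containing `⟨a; b⟩`, such that every configuration in `W` satisfies
the 0-round winning conditions and such that from every configuration in `W`, every
spoiler move has a legal duplicator answer leading again to a configuration in `W`. -/
def DuplicatorWinsInf {S : Type} {ar : S → ℕ} {Ω : Type} {ωar : Ω → ℕ} {U : Type}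
    (A B : ∀ R : S, Set (Fin (ar R) → U))
    (I : ∀ p : Ω, (Fin (ωar p) → U) → Prop)
    {k : ℕ} (a b : Fin k → U) : Prop :=
  ∃ W : ∀ l : ℕ, (Fin l → U) → (Fin l → U) → Prop,
    W k a b ∧
    ∀ (l : ℕ) (x y : Fin l → U), W l x y →
      (samePos A B x y ∧ sameAtomic I x y) ∧
      (∀ (j : ℕ) (c : Fin j → U), inTupleSpace A c →
        ∃ d : Fin j → U, inTupleSpace B d ∧ samePos A B c d ∧
          sameAtomic I (Fin.append x c) (Fin.append y d) ∧ W j c d) ∧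
      (∀ (j : ℕ) (d : Fin j → U), inTupleSpace B d →
        ∃ c : Fin j → U, inTupleSpace A c ∧ samePos A B c d ∧
          sameAtomic I (Fin.append x c) (Fin.append y d) ∧ W j c d)

section SemijoinGame

variable {U S Ω : Type} {ar : S → ℕ} {ωar : Ω → ℕ}
  {I : ∀ p : Ω, (Fin (ωar p) → U) → Prop} {A B D : ∀ R : S, Set (Fin (ar R) → U)}

theorem sameAtomic.symm {k : ℕ} {a b : Fin k → U} (h : sameAtomic I a b) : sameAtomic I b a :=
  ⟨fun i j => (h.1 i j).symm, fun p v => (h.2 p v).symm⟩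

theorem sameAtomic.holds_iff {n : ℕ} {a b : Fin n → U} (h : sameAtomic I a b)
    (θ : QF Ω ωar n) : QF.holds I θ a ↔ QF.holds I θ b := by
  induction θ with
  | atom p v => simpa only [QF.holds] using h.2 p v
  | eq i j => simpa only [QF.holds] using h.1 i j
  | not φ ih => simp only [QF.holds, ih]
  | and φ ψ ih₁ ih₂ => simp only [QF.holds, ih₁, ih₂]
  | or φ ψ ih₁ ih₂ => simp only [QF.holds, ih₁, ih₂]

theorem sameAtomic_of_holds_imp {n : ℕ} {a b : Fin n → U}
    (h : ∀ θ : QF Ω ωar n, QF.holds I θ a → QF.holds I θ b) : sameAtomic I a b := by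
  have hiff (θ : QF Ω ωar n) : QF.holds I θ a ↔ QF.holds I θ b :=
    ⟨h θ, fun hb => by_contra fun ha => by
      have := h (.not θ)
      simp only [QF.holds] at this
      exact this ha hb⟩
  constructor
  · intro i j
    simpa only [QF.holds] using hiff (.eq i j)
  · intro p v
    simpa only [QF.holds] using hiff (.atom p v)

theorem inTupleSpace.comp {k n : ℕ} {t : Fin n → U} (h : inTupleSpace D t)
    {f : Fin k → Fin n} (hf : StrictMono f) : inTupleSpace D (t ∘ f) := by
  obtain ⟨R, g, hg, a, ha, rfl⟩ := h
  exact ⟨R, g ∘ f, hg.comp hf, a, ha, rfl⟩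

theorem inTupleSpace_of_mem_eval {n : ℕ} (E : SA S ar Ω ωar n) {t : Fin n → U}
    (h : t ∈ E.eval I D) : inTupleSpace D t := by
  induction E with
  | rel R => exact ⟨R, id, strictMono_id, t, h, rfl⟩
  | union E₁ E₂ ih₁ ih₂ => exact h.elim ih₁ ih₂
  | diff E₁ E₂ ih₁ ih₂ => exact ih₁ h.1
  | proj f hf E ih =>
    obtain ⟨a, ha, rfl⟩ := h
    exact (ih ha).comp hf
  | sel θ E ih => exact ih h.1
  | semijoin θ E₁ E₂ ih₁ ih₂ => exact ih₁ h.1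

theorem inTupleSpace.exists_eval {k : ℕ} {t : Fin k → U} (h : inTupleSpace D t) :
    ∃ E : SA S ar Ω ωar k, t ∈ E.eval I D := by
  obtain ⟨R, f, hf, a, ha, rfl⟩ := h
  exact ⟨.proj f hf (.rel R), a, ha, rfl⟩

theorem finite_inTupleSpace [Finite S] (hD : ∀ R : S, (D R).Finite) (k : ℕ) :
    {t : Fin k → U | inTupleSpace D t}.Finite := by
  refine (Set.finite_iUnion fun R : S => Set.finite_iUnion fun f : Fin k → Fin (ar R) =>
    (hD R).image (· ∘ f)).subset ?_
  rintro t ⟨R, f, -, a, ha, rfl⟩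
  exact Set.mem_iUnion.2 ⟨R, Set.mem_iUnion.2 ⟨f, a, ha, rfl⟩⟩

theorem samePos_of_mem_eval_iff {k : ℕ} {a b : Fin k → U}
    (h : ∀ E : SA S ar Ω ωar k, a ∈ E.eval I A ↔ b ∈ E.eval I B) : samePos A B a b :=
  fun R f hf => h (.proj f hf (.rel R))

theorem sameAtomic_of_mem_eval_iff {k : ℕ} {a b : Fin k → U} (ha : inTupleSpace A a)
    (h : ∀ E : SA S ar Ω ωar k, a ∈ E.eval I A ↔ b ∈ E.eval I B) : sameAtomic I a b := by
  obtain ⟨E, hE⟩ := ha.exists_eval (I := I)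
  exact sameAtomic_of_holds_imp fun θ hθ => ((h (.sel θ E)).1 ⟨hE, hθ⟩).2

theorem sameAtomic_of_eq_zero {n : ℕ} (hn : n = 0) (a b : Fin n → U) : sameAtomic I a b := by
  subst hn
  rw [Subsingleton.elim a b]
  exact ⟨fun _ _ => Iff.rfl, fun _ _ => Iff.rfl⟩

/-- Tuples that cannot be told apart from `c` can be excluded, finitely many at once, by a single
expression and a single join condition. -/
theorem exists_separating {l j : ℕ} (hlj : l + j ≠ 0) {x y : Fin l → U} {c : Fin j → U}
    (hc : inTupleSpace A c) {T : Set (Fin j → U)} (hT : T.Finite)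
    (h : ∀ d ∈ T, sameAtomic I (Fin.append x c) (Fin.append y d) →
      ∃ E : SA S ar Ω ωar j, ¬ (c ∈ E.eval I A ↔ d ∈ E.eval I B)) :
    ∃ (θ : QF Ω ωar (l + j)) (E : SA S ar Ω ωar j),
      QF.holds I θ (Fin.append x c) ∧ c ∈ E.eval I A ∧
      ∀ d ∈ T, d ∈ E.eval I B → ¬ QF.holds I θ (Fin.append y d) := by
  obtain ⟨P, hP⟩ := hc.exists_eval (I := I)
  induction T, hT using Set.Finite.induction_on with
  | empty =>
    let i : Fin (l + j) := ⟨0, Nat.pos_of_ne_zero hlj⟩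
    exact ⟨.eq i i, P, by simp only [QF.holds], hP, by simp⟩
  | @insert d T _ _ ih =>
    obtain ⟨θ, E, hθ, hE, hsep⟩ := ih fun d' hd' => h d' (Set.mem_insert_of_mem _ hd')
    by_cases hat : sameAtomic I (Fin.append x c) (Fin.append y d)
    · obtain ⟨F, hF⟩ := h d (Set.mem_insert _ _) hat
      by_cases hcF : c ∈ F.eval I A
      · refine ⟨θ, .diff E (.diff E F), hθ, ⟨hE, fun hm => hm.2 hcF⟩, ?_⟩
        rintro d' (rfl | hd') hd'E
        · exact absurd ⟨hd'E.1, fun hdF => hF (iff_of_true hcF hdF)⟩ hd'E.2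
        · exact hsep d' hd' hd'E.1
      · refine ⟨θ, .diff E F, hθ, ⟨hE, hcF⟩, ?_⟩
        rintro d' (rfl | hd') hd'E
        · exact absurd (iff_of_false hcF hd'E.2) hF
        · exact hsep d' hd' hd'E.1
    · obtain ⟨φ, hφ, hφ'⟩ : ∃ φ : QF Ω ωar (l + j),
          QF.holds I φ (Fin.append x c) ∧ ¬ QF.holds I φ (Fin.append y d) := by
        by_contra! hall
        exact hat (sameAtomic_of_holds_imp hall)
      refine ⟨.and θ φ, E, by simp only [QF.holds, hθ, hφ, and_self], hE, ?_⟩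
      simp only [QF.holds]
      rintro d' (rfl | hd') hd'E
      · exact fun hm => hφ' hm.2
      · exact fun hm => hsep d' hd' hd'E hm.1

theorem exists_answer [Finite S] (hB : ∀ R : S, (B R).Finite) {l j : ℕ} {x y : Fin l → U}
    (hx : inTupleSpace A x) (hy : inTupleSpace B y)
    (h : ∀ E : SA S ar Ω ωar l, x ∈ E.eval I A ↔ y ∈ E.eval I B)
    {c : Fin j → U} (hc : inTupleSpace A c) :
    ∃ d : Fin j → U, inTupleSpace B d ∧ sameAtomic I (Fin.append x c) (Fin.append y d) ∧
      ∀ E : SA S ar Ω ωar j, c ∈ E.eval I A ↔ d ∈ E.eval I B := by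
  by_cases hlj : l + j = 0
  · obtain ⟨rfl, rfl⟩ := Nat.add_eq_zero_iff.1 hlj
    rw [Subsingleton.elim c x]
    exact ⟨y, hy, sameAtomic_of_eq_zero rfl _ _, h⟩
  · by_contra! hno
    obtain ⟨θ, E, hθ, hE, hsep⟩ := exists_separating (B := B) (y := y) hlj hc
      (finite_inTupleSpace hB j) fun d hd hat => by
        obtain ⟨E, hE⟩ := hno d hd hat
        exact ⟨E, by tauto⟩
    obtain ⟨P, hP⟩ := hx.exists_eval (I := I)
    obtain ⟨-, d, hd, hdθ⟩ := (h (.semijoin θ P E)).1 ⟨hP, c, hE, hθ⟩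
    exact hsep d (inTupleSpace_of_mem_eval E hd) hd hdθ

theorem comp_eq_of_sameAtomic_append {l n : ℕ} {x y : Fin l → U} {c d : Fin n → U}
    (h : sameAtomic I (Fin.append x c) (Fin.append y d)) {f : Fin l → Fin n}
    (hx : x = c ∘ f) : y = d ∘ f := by
  funext i
  simpa using (h.1 (Fin.castAdd n i) (Fin.natAdd l (f i))).1 (by simpa using congrFun hx i)

theorem DuplicatorWinsInf.mem_eval_iff {k : ℕ} {a b : Fin k → U}
    (h : DuplicatorWinsInf A B I a b) (E : SA S ar Ω ωar k) :
    a ∈ E.eval I A ↔ b ∈ E.eval I B := by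
  obtain ⟨W, hab, hW⟩ := h
  induction E with
  | rel R => simpa [SA.eval] using (hW _ a b hab).1.1 R id strictMono_id
  | union E₁ E₂ ih₁ ih₂ => exact or_congr (ih₁ hab) (ih₂ hab)
  | diff E₁ E₂ ih₁ ih₂ => exact and_congr (ih₁ hab) (not_congr (ih₂ hab))
  | proj f hf E ih =>
    obtain ⟨-, hforth, hback⟩ := hW _ a b hab
    constructor
    · rintro ⟨c, hc, hac⟩
      obtain ⟨d, -, -, hat, hcd⟩ := hforth _ c (inTupleSpace_of_mem_eval E hc)
      exact ⟨d, (ih hcd).1 hc, comp_eq_of_sameAtomic_append hat hac⟩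
    · rintro ⟨d, hd, hbd⟩
      obtain ⟨c, -, -, hat, hcd⟩ := hback _ d (inTupleSpace_of_mem_eval E hd)
      exact ⟨c, (ih hcd).2 hd, comp_eq_of_sameAtomic_append hat.symm hbd⟩
  | sel θ E ih => exact and_congr (ih hab) ((hW _ a b hab).1.2.holds_iff θ)
  | semijoin θ E₁ E₂ ih₁ ih₂ =>
    obtain ⟨-, hforth, hback⟩ := hW _ a b hab
    refine and_congr (ih₁ hab) ⟨?_, ?_⟩
    · rintro ⟨c, hc, hθ⟩
      obtain ⟨d, -, -, hat, hcd⟩ := hforth _ c (inTupleSpace_of_mem_eval E₂ hc)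
      exact ⟨d, (ih₂ hcd).1 hc, (hat.holds_iff θ).1 hθ⟩
    · rintro ⟨d, hd, hθ⟩
      obtain ⟨c, -, -, hat, hcd⟩ := hback _ d (inTupleSpace_of_mem_eval E₂ hd)
      exact ⟨c, (ih₂ hcd).2 hd, (hat.holds_iff θ).2 hθ⟩

end SemijoinGame

/-- The duplicator wins the infinite semijoin game `SG⟨a; b⟩` iff
for every semijoin algebra expression `E`, `a ∈ E(A) ⇔ b ∈ E(B)`. (Here, as always,
the schema and the vocabulary are finite and the databases are finite.) -/
theorem stmt9 {U : Type} {S : Type} {Ω : Type} [Fintype S] [Fintype Ω]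
    (ar : S → ℕ) (ωar : Ω → ℕ)
    (I : ∀ p : Ω, (Fin (ωar p) → U) → Prop)
    (A B : ∀ R : S, Set (Fin (ar R) → U))
    (hA : ∀ R : S, (A R).Finite) (hB : ∀ R : S, (B R).Finite)
    {k : ℕ} (a b : Fin k → U)
    (ha : inTupleSpace A a) (hb : inTupleSpace B b) :
    DuplicatorWinsInf A B I a b ↔
      ∀ E : SA S ar Ω ωar k, (a ∈ E.eval I A ↔ b ∈ E.eval I B) := by
  refine ⟨DuplicatorWinsInf.mem_eval_iff, fun h => ?_⟩
  refine ⟨fun l x y => inTupleSpace A x ∧ inTupleSpace B y ∧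
    ∀ E : SA S ar Ω ωar l, x ∈ E.eval I A ↔ y ∈ E.eval I B, ⟨ha, hb, h⟩, ?_⟩
  rintro l x y ⟨hx, hy, hxy⟩
  refine ⟨⟨samePos_of_mem_eval_iff hxy, sameAtomic_of_mem_eval_iff hx hxy⟩, ?_, ?_⟩
  · intro j c hc
    obtain ⟨d, hd, hat, hcd⟩ := exists_answer hB hx hy hxy hc
    exact ⟨d, hd, samePos_of_mem_eval_iff hcd, hat, hc, hd, hcd⟩
  · intro j d hd
    obtain ⟨c, hc, hat, hdc⟩ := exists_answer hA hy hx (fun E => (hxy E).symm) hd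
    have hcd := fun E => (hdc E).symm
    exact ⟨c, hc, samePos_of_mem_eval_iff hcd, hat.symm, hc, hd, hcd⟩
end

section
/- The query asking whether R = π_1(R) × π_2(R), for a binary relation R, is inexpressible in the semijoin algebra: there is no 0-ary SA expression E such that for every database D over the schema {R}, E(D) ≠ ∅ if and only if D(R) equals the cartesian product of its first projection with its second projection. -/
/-- Two tuples have the same equality type. -/
def SameEqType {ι U V : Type} (a : ι → U) (b : ι → V) : Prop :=
  ∀ i j, a i = a j ↔ b i = b j

namespace SameEqType

variable {ι κ U V : Type} {a : ι → U} {b : ι → V}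

theorem comp (h : SameEqType a b) (f : κ → ι) : SameEqType (a ∘ f) (b ∘ f) :=
  fun i j => h (f i) (f j)

theorem left_eq_right {a c : ι → U} {b d : ι → V}
    (h : SameEqType (Sum.elim a c) (Sum.elim b d)) {f g : κ → ι} (hac : a ∘ f = c ∘ g) :
    b ∘ f = d ∘ g :=
  funext fun i => (h (.inl (f i)) (.inr (g i))).1 (congrFun hac i)

theorem append {k n m : ℕ} {a c : Fin k → U} {b d : Fin k → V}
    (h : SameEqType (Sum.elim a c) (Sum.elim b d)) (f : Fin n → Fin k) (g : Fin m → Fin k) :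
    SameEqType (Fin.append (a ∘ f) (c ∘ g)) (Fin.append (b ∘ f) (d ∘ g)) := by
  have key : ∀ {W : Type} (x y : Fin k → W), Fin.append (x ∘ f) (y ∘ g) =
      Sum.elim x y ∘ Sum.map f g ∘ finSumFinEquiv.symm := by
    intro W x y
    ext i
    refine Fin.addCases (fun i => ?_) (fun i => ?_) i <;> simp
  rw [key, key]
  exact h.comp _

theorem holds_iff {n : ℕ} {a : Fin n → U} {b : Fin n → V} (h : SameEqType a b)
    (θ : QF Empty (fun p => p.elim) n) :
    QF.holds (fun p => p.elim) θ a ↔ QF.holds (fun p => p.elim) θ b := by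
  induction θ with
  | atom p => exact p.elim
  | eq i j => simpa only [QF.holds] using h i j
  | not φ ih => simpa only [QF.holds] using not_congr ih
  | and φ ψ ih₁ ih₂ => simpa only [QF.holds] using and_congr ih₁ ih₂
  | or φ ψ ih₁ ih₂ => simpa only [QF.holds] using or_congr ih₁ ih₂

end SameEqType

/-- Whatever tuples `a ∈ D` and `b ∈ D'` have been reached, every `c ∈ D` is answered by some
`d ∈ D'` such that `(a, c)` and `(b, d)` have the same equality type. -/
def Simulates {k : ℕ} {U V : Type} (D : Set (Fin k → U)) (D' : Set (Fin k → V)) : Prop :=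
  ∀ a ∈ D, ∀ b ∈ D', ∀ c ∈ D, ∃ d ∈ D', SameEqType (Sum.elim a c) (Sum.elim b d)

namespace SA

variable {U V : Type} {k : ℕ}

/-- Evaluation over a single relation, with equality as the only predicate. -/
abbrev evalEq (D : Set (Fin k → U)) {n : ℕ}
    (E : SA Unit (fun _ => k) Empty (fun p => p.elim) n) : Set (Fin n → U) :=
  E.eval (fun p => p.elim) (fun _ : Unit => D)

theorem exists_of_mem_evalEq {D : Set (Fin k → U)} {n : ℕ}
    (E : SA Unit (fun _ => k) Empty (fun p => p.elim) n) {t : Fin n → U} (ht : t ∈ evalEq D E) :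
    ∃ a ∈ D, ∃ f : Fin n → Fin k, StrictMono f ∧ t = a ∘ f := by
  induction E with
  | rel R => exact ⟨t, ht, id, strictMono_id, rfl⟩
  | union E₁ E₂ ih₁ ih₂ => exact ht.elim ih₁ ih₂
  | diff E₁ E₂ ih₁ _ => exact ih₁ ht.1
  | proj g hg E ih =>
    obtain ⟨s, hs, rfl⟩ := ht
    obtain ⟨a, ha, f, hf, rfl⟩ := ih hs
    exact ⟨a, ha, f ∘ g, hf.comp hg, rfl⟩
  | sel θ E ih => exact ih ht.1
  | semijoin θ E₁ E₂ ih₁ _ => exact ih₁ ht.1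

theorem mem_evalEq_iff {D : Set (Fin k → U)} {D' : Set (Fin k → V)} (h : Simulates D D')
    (h' : Simulates D' D) {n : ℕ} (E : SA Unit (fun _ => k) Empty (fun p => p.elim) n)
    {a : Fin k → U} (ha : a ∈ D) {b : Fin k → V} (hb : b ∈ D')
    {f : Fin n → Fin k} (hf : StrictMono f) :
    a ∘ f ∈ evalEq D E ↔ b ∘ f ∈ evalEq D' E := by
  induction E generalizing a b with
  | rel R =>
    obtain rfl : f = id := hf.eq_id
    exact iff_of_true ha hb
  | union E₁ E₂ ih₁ ih₂ => exact or_congr (ih₁ ha hb hf) (ih₂ ha hb hf)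
  | diff E₁ E₂ ih₁ ih₂ => exact and_congr (ih₁ ha hb hf) (not_congr (ih₂ ha hb hf))
  | proj g hg E ih =>
    constructor
    · rintro ⟨s, hs, hac⟩
      obtain ⟨c, hc, p, hp, rfl⟩ := exists_of_mem_evalEq E hs
      obtain ⟨d, hd, hcd⟩ := h a ha b hb c hc
      exact ⟨d ∘ p, (ih hc hd hp).1 hs, hcd.left_eq_right (g := p ∘ g) hac⟩
    · rintro ⟨s, hs, hbd⟩
      obtain ⟨d, hd, p, hp, rfl⟩ := exists_of_mem_evalEq E hs
      obtain ⟨c, hc, hcd⟩ := h' b hb a ha d hd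
      exact ⟨c ∘ p, (ih hc hd hp).2 hs, hcd.left_eq_right (g := p ∘ g) hbd⟩
  | sel θ E ih =>
    obtain ⟨d, -, hd⟩ := h a ha b hb a ha
    exact and_congr (ih ha hb hf) ((hd.comp (Sum.inl ∘ f)).holds_iff θ)
  | semijoin θ E₁ E₂ ih₁ ih₂ =>
    refine and_congr (ih₁ ha hb hf) ⟨?_, ?_⟩
    · rintro ⟨s, hs, hθ⟩
      obtain ⟨c, hc, p, hp, rfl⟩ := exists_of_mem_evalEq E₂ hs
      obtain ⟨d, hd, hcd⟩ := h a ha b hb c hc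
      exact ⟨d ∘ p, (ih₂ hc hd hp).1 hs, ((hcd.append f p).holds_iff θ).1 hθ⟩
    · rintro ⟨s, hs, hθ⟩
      obtain ⟨d, hd, p, hp, rfl⟩ := exists_of_mem_evalEq E₂ hs
      obtain ⟨c, hc, hcd⟩ := h' b hb a ha d hd
      exact ⟨c ∘ p, (ih₂ hc hd hp).2 hs, ((hcd.append f p).holds_iff θ).1 hθ⟩

theorem evalEq_nonempty_iff {D : Set (Fin k → U)} {D' : Set (Fin k → V)} (h : Simulates D D')
    (h' : Simulates D' D) (hD : D.Nonempty) (hD' : D'.Nonempty)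
    (E : SA Unit (fun _ => k) Empty (fun p => p.elim) 0) :
    (evalEq D E).Nonempty ↔ (evalEq D' E).Nonempty := by
  obtain ⟨a, ha⟩ := hD
  obtain ⟨b, hb⟩ := hD'
  have key := mem_evalEq_iff h h' E ha hb (f := Fin.elim0) (fun i => i.elim0)
  constructor
  · rintro ⟨t, ht⟩
    exact ⟨_, key.1 (by rwa [Subsingleton.elim (a ∘ Fin.elim0) t])⟩
  · rintro ⟨t, ht⟩
    exact ⟨_, key.2 (by rwa [Subsingleton.elim (b ∘ Fin.elim0) t])⟩

end SA

theorem SameEqType.comp_injective {ι U V U' V' : Type} {a : ι → U} {b : ι → V}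
    (h : SameEqType a b) {e : U → U'} {e' : V → V'} (he : e.Injective) (he' : e'.Injective) :
    SameEqType (e ∘ a) (e' ∘ b) :=
  fun i j => he.eq_iff.trans ((h i j).trans he'.eq_iff.symm)

theorem Simulates.image {k : ℕ} {U V U' V' : Type} {D : Set (Fin k → U)} {D' : Set (Fin k → V)}
    (h : Simulates D D') {e : U → U'} {e' : V → V'} (he : e.Injective) (he' : e'.Injective) :
    Simulates ((e ∘ ·) '' D) ((e' ∘ ·) '' D') := by
  rintro _ ⟨a, ha, rfl⟩ _ ⟨b, hb, rfl⟩ _ ⟨c, hc, rfl⟩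
  obtain ⟨d, hd, hcd⟩ := h a ha b hb c hc
  refine ⟨_, ⟨d, hd, rfl⟩, ?_⟩
  simpa only [Sum.comp_elim] using hcd.comp_injective he he'

/-- The complete bipartite graph on parts `{0, 1}` and `{3, 4}`, as a binary relation. -/
def completeEdges : Finset (Fin 2 → Fin 6) :=
  {![0, 3], ![0, 4], ![1, 3], ![1, 4]}

/-- The hexagon with parts `{0, 1, 2}` and `{3, 4, 5}`, as a binary relation. -/
def hexagonEdges : Finset (Fin 2 → Fin 6) :=
  {![0, 4], ![0, 5], ![1, 3], ![1, 5], ![2, 3], ![2, 4]}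

instance {ι U V : Type} [Fintype ι] [DecidableEq U] [DecidableEq V] (a : ι → U) (b : ι → V) :
    Decidable (SameEqType a b) :=
  inferInstanceAs (Decidable (∀ i j, a i = a j ↔ b i = b j))

theorem simulates_completeEdges_hexagonEdges :
    Simulates (completeEdges : Set (Fin 2 → Fin 6)) (hexagonEdges : Set (Fin 2 → Fin 6)) := by
  have : ∀ a ∈ completeEdges, ∀ b ∈ hexagonEdges, ∀ c ∈ completeEdges, ∃ d ∈ hexagonEdges,
      SameEqType (Sum.elim a c) (Sum.elim b d) := by
    decide
  exact this

theorem simulates_hexagonEdges_completeEdges :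
    Simulates (hexagonEdges : Set (Fin 2 → Fin 6)) (completeEdges : Set (Fin 2 → Fin 6)) := by
  have : ∀ a ∈ hexagonEdges, ∀ b ∈ completeEdges, ∀ c ∈ hexagonEdges, ∃ d ∈ completeEdges,
      SameEqType (Sum.elim a c) (Sum.elim b d) := by
    decide
  exact this

/-- The query asking whether `R = π₁(R) × π₂(R)`, for a binary
relation `R`, is inexpressible in the semijoin algebra: over the schema with a single
binary relation name `R` and vocabulary `Ω = {=}` (encoded as `Ω = Empty`, since
equality is built in), there is no 0-ary SA expression `E` such that for every
database `D`, `E(D) ≠ ∅` iff `D(R)` equals the cartesian product of its first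
projection with its second projection. -/
theorem stmt11 {U : Type} [Infinite U] :
    ¬ ∃ E : SA Unit (fun _ => 2) Empty (fun p => p.elim) 0,
        ∀ D : Set (Fin 2 → U), D.Finite →
          (((E.eval (fun p => p.elim) (fun _ : Unit => D)).Nonempty) ↔
            D = {t : Fin 2 → U | (∃ s ∈ D, s 0 = t 0) ∧ ∃ s ∈ D, s 1 = t 1}) := by
  rintro ⟨E, hE⟩
  obtain ⟨e, he⟩ : ∃ e : Fin 6 → U, e.Injective :=
    ⟨_, ((Fin.valEmbedding (n := 6)).trans (Infinite.natEmbedding U)).injective⟩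
  set D : Set (Fin 2 → U) := (e ∘ ·) '' (completeEdges : Set (Fin 2 → Fin 6)) with hD
  set D' : Set (Fin 2 → U) := (e ∘ ·) '' (hexagonEdges : Set (Fin 2 → Fin 6)) with hD'
  have hiff : (SA.evalEq D E).Nonempty ↔ (SA.evalEq D' E).Nonempty :=
    SA.evalEq_nonempty_iff (simulates_completeEdges_hexagonEdges.image he he)
      (simulates_hexagonEdges_completeEdges.image he he)
      ⟨_, ![0, 3], by decide, rfl⟩ ⟨_, ![0, 4], by decide, rfl⟩ E
  have hprod : D = {t : Fin 2 → U | (∃ s ∈ D, s 0 = t 0) ∧ ∃ s ∈ D, s 1 = t 1} := by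
    refine Set.Subset.antisymm (fun t ht => ⟨⟨t, ht, rfl⟩, t, ht, rfl⟩) ?_
    rintro t ⟨⟨_, ⟨x, hx, rfl⟩, h0⟩, _, ⟨y, hy, rfl⟩, h1⟩
    have hmem : ∀ x ∈ completeEdges, ∀ y ∈ completeEdges, ![x 0, y 1] ∈ completeEdges := by
      decide
    refine ⟨![x 0, y 1], hmem x hx y hy, ?_⟩
    ext i
    fin_cases i
    exacts [h0, h1]
  have hprod' := (hE D' (hexagonEdges.finite_toSet.image _)).1
    (hiff.1 ((hE D (completeEdges.finite_toSet.image _)).2 hprod))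
  have hmem : e ∘ ![0, 3] ∈ D' := by
    rw [hprod']
    exact ⟨⟨_, ⟨![0, 4], by decide, rfl⟩, rfl⟩, _, ⟨![1, 3], by decide, rfl⟩, rfl⟩
  obtain ⟨x, hx, hxe⟩ := hmem
  obtain rfl : x = ![0, 3] := he.comp_left hxe
  exact absurd hx (by decide)
end
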